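/- arXiv:2101.00778 — 4 statements merged into one kernel-verified Lean document; each statement's English description precedes it below -/
import Mathlib

section
/- Let M, V, A be natural numbers with 1 ≤ A ≤ V < M, and let r_l, p_l, P be real numbers with r_l > 0. Define C^s : {0,1,...,M} → ℝ by C^s(n) = 0 if n ≤ V − A, C^s(n) = r_l·(n − (V − A)) if V − A < n ≤ V, and C^s(n) = r_l·A if V + 1 ≤ n ≤ M, and define the seller's utility 𝒰^s(n) = n·p_l + A·P − C^s(n). Then the expected utility over the uniform distribution on {0,1,...,M} satisfies (1/(M+1))·Σ_{n=0}^{M} 𝒰^s(n) = −r_l·A²/(2(M+1)) + (P − (r_l + 2M·r_l − 2V·r_l)/(2(M+1)))·A + p_l·M/2. -/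
lemma sum_range_natCast_real (k : ℕ) :
    ∑ n ∈ Finset.range k, (n : ℝ) = (k : ℝ) * ((k : ℝ) - 1) / 2 := by
  induction k with
  | zero => simp
  | succ k ih =>
    rw [Finset.sum_range_succ, ih]
    push_cast
    ring

/-- The sum of a cost that vanishes up to `b`, grows with slope `r` on the next `a` points and
stays constant on the last `c` points. -/
lemma sum_range_ramp (b a c : ℕ) (r : ℝ) (f : ℕ → ℝ)
    (h_zero : ∀ n ≤ b, f n = 0)
    (h_ramp : ∀ i < a, f (b + 1 + i) = r * ((i : ℝ) + 1))
    (h_const : ∀ i < c, f (b + 1 + a + i) = r * (a : ℝ)) :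
    ∑ n ∈ Finset.range (b + 1 + a + c), f n =
      r * ((a : ℝ) * ((a : ℝ) + 1) / 2 + (c : ℝ) * (a : ℝ)) := by
  rw [Finset.sum_range_add, Finset.sum_range_add,
    Finset.sum_eq_zero fun n hn => h_zero n (Finset.mem_range_succ_iff.mp hn),
    Finset.sum_congr rfl fun i hi => h_ramp i (Finset.mem_range.mp hi),
    Finset.sum_congr rfl fun i hi => h_const i (Finset.mem_range.mp hi),
    ← Finset.mul_sum, Finset.sum_add_distrib, sum_range_natCast_real]
  simp only [Finset.sum_const, Finset.card_range, nsmul_eq_mul]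
  ring

theorem stmt_1 (M V A : ℕ) (hA : 1 ≤ A) (hAV : A ≤ V) (hVM : V < M)
    (r p P : ℝ) (hr : 0 < r) (Cs Us : ℕ → ℝ)
    (hCs : ∀ n ≤ M, Cs n =
      if n + A ≤ V then 0
      else if n ≤ V then r * ((n : ℝ) - ((V : ℝ) - (A : ℝ)))
      else r * (A : ℝ))
    (hUs : ∀ n ≤ M, Us n = (n : ℝ) * p + (A : ℝ) * P - Cs n) :
    (1 / ((M : ℝ) + 1)) * ∑ n ∈ Finset.range (M + 1), Us n =
      -(r * (A : ℝ) ^ 2) / (2 * ((M : ℝ) + 1)) +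
        (P - (r + 2 * (M : ℝ) * r - 2 * (V : ℝ) * r) / (2 * ((M : ℝ) + 1))) * (A : ℝ) +
        p * (M : ℝ) / 2 := by
  obtain ⟨b, rfl⟩ := Nat.exists_eq_add_of_le' hAV
  obtain ⟨c, rfl⟩ := Nat.exists_eq_add_of_le hVM.le
  have h_cost : ∑ n ∈ Finset.range (b + A + c + 1), Cs n =
      r * ((A : ℝ) * ((A : ℝ) + 1) / 2 + (c : ℝ) * (A : ℝ)) := by
    rw [show b + A + c + 1 = b + 1 + A + c by ring]
    refine sum_range_ramp b A c r Cs (fun n hn => ?_) (fun i hi => ?_) (fun i hi => ?_)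
    · rw [hCs n (by lia), if_pos (by lia)]
    · rw [hCs _ (by lia), if_neg (by lia), if_pos (by lia)]
      push_cast
      ring
    · rw [hCs _ (by lia), if_neg (by lia), if_neg (by lia)]
  rw [Finset.sum_congr rfl fun n hn => hUs n (Finset.mem_range_succ_iff.mp hn),
    Finset.sum_sub_distrib, Finset.sum_add_distrib, h_cost, ← Finset.sum_mul,
    sum_range_natCast_real]
  simp only [Finset.sum_const, Finset.card_range, nsmul_eq_mul]
  push_cast
  have h_pos : (b : ℝ) + A + c + 1 ≠ 0 := by positivity
  field_simp
  ring
end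

section
/- Let N, A be natural numbers with 1 ≤ A ≤ N, let q > 0, 0 < ε₁ < ε₂, and let τ^b, τ^s, D > 0, W > 0, ω₁, ω₂, ℓ, P be real numbers. Define, for n ∈ {1,...,N} and g ∈ [ε₁, ε₂], 𝒰^b(g, n) = min(A,n)·τ^b − (τ^s + min(A,n)·D/(W·log₂(1 + q·g))) − ω₁·A·P − ω₂·(q·min(A,n)·D/(W·log₂(1 + q·g)) + ℓ). Then (1/N)·Σ_{n=1}^{N} (1/(ε₂ − ε₁))·∫_{ε₁}^{ε₂} 𝒰^b(g, n) dg = −C₂·A²/(2N) + (C₂ + C₂/(2N) − ω₁·P)·A − τ^s − ω₂·ℓ, where C₂ = τ^b − ((D + ω₂·q·D)/W) · (ln 2 · ∫_{ln(1+q·ε₁)}^{ln(1+q·ε₂)} e^x/x dx) / (q·(ε₂ − ε₁)). -/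
theorem sum_Icc_one_min (A N : ℕ) (hAN : A ≤ N) :
    ∑ n ∈ Finset.Icc 1 N, min (A : ℝ) (n : ℝ) = A * (A + 1) / 2 + (N - A) * A := by
  induction N, hAN using Nat.le_induction with
  | base =>
    have h : ∀ M : ℕ, M ≤ A → ∑ n ∈ Finset.Icc 1 M, min (A : ℝ) (n : ℝ) = M * (M + 1) / 2 := by
      intro M
      induction M with
      | zero => simp
      | succ M ih =>
        intro hM
        have hM' : ((M + 1 : ℕ) : ℝ) ≤ A := by exact_mod_cast hM
        rw [Finset.sum_Icc_succ_top (by omega), ih (by omega), min_eq_right hM']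
        push_cast
        ring
    rw [h A le_rfl]
    ring
  | succ M hM ih =>
    have hM' : (A : ℝ) ≤ ((M + 1 : ℕ) : ℝ) := by exact_mod_cast hM.trans M.le_succ
    rw [Finset.sum_Icc_succ_top (by omega), ih, min_eq_left hM']
    push_cast
    ring

theorem log_one_add_mul_pos {q a b g : ℝ} (hq : 0 < q) (ha : 0 < a) (hab : a < b)
    (hg : g ∈ Set.uIcc a b) : 0 < Real.log (1 + q * g) := by
  rw [Set.uIcc_of_le hab.le] at hg
  have := mul_pos hq (ha.trans_le hg.1)
  exact Real.log_pos (by linarith)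

theorem one_add_mul_pos {q a b g : ℝ} (hq : 0 < q) (ha : 0 < a) (hab : a < b)
    (hg : g ∈ Set.uIcc a b) : 0 < 1 + q * g := by
  rw [Set.uIcc_of_le hab.le] at hg
  have := mul_pos hq (ha.trans_le hg.1)
  linarith

theorem continuousOn_log_one_add_mul {q a b : ℝ} (hq : 0 < q) (ha : 0 < a) (hab : a < b) :
    ContinuousOn (fun g => Real.log (1 + q * g)) (Set.uIcc a b) :=
  ContinuousOn.log (by fun_prop) fun _ hg => (one_add_mul_pos hq ha hab hg).ne'

theorem integral_exp_div_eq {q a b : ℝ} (hq : 0 < q) (ha : 0 < a) (hab : a < b) :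
    ∫ x in Real.log (1 + q * a)..Real.log (1 + q * b), Real.exp x / x =
      q * ∫ g in a..b, (Real.log (1 + q * g))⁻¹ := by
  rw [← intervalIntegral.integral_comp_mul_deriv'' (f := fun g => Real.log (1 + q * g))
    (f' := fun g => q / (1 + q * g)) (continuousOn_log_one_add_mul hq ha hab),
    ← intervalIntegral.integral_const_mul]
  · refine intervalIntegral.integral_congr fun g hg => ?_
    have h1 := one_add_mul_pos hq ha hab hg
    simp only [Function.comp_apply, Real.exp_log h1]
    field_simp
  · intro g hg
    have h1 := one_add_mul_pos hq ha hab (Set.Ioo_subset_Icc_self hg)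
    have h2 : HasDerivAt (fun g => 1 + q * g) q g := by
      simpa using ((hasDerivAt_id g).const_mul q).const_add 1
    exact (h2.log h1.ne').hasDerivWithinAt
  · exact ContinuousOn.div (by fun_prop) (by fun_prop)
      fun _ hg => (one_add_mul_pos hq ha hab hg).ne'
  · refine ContinuousOn.div (by fun_prop) (by fun_prop) ?_
    rintro _ ⟨g, hg, rfl⟩
    exact (log_one_add_mul_pos hq ha hab hg).ne'


theorem stmt_9 (N A : ℕ) (hA : 1 ≤ A) (hAN : A ≤ N)
    (q ε₁ ε₂ τb τs D W ω₁ ω₂ ℓ P : ℝ)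
    (hq : 0 < q) (hε₁ : 0 < ε₁) (hε : ε₁ < ε₂) (hD : 0 < D) (hW : 0 < W)
    (C₂ : ℝ)
    (hC₂ : C₂ = τb - ((D + ω₂ * q * D) / W) *
      (Real.log 2 * ∫ x in Real.log (1 + q * ε₁)..Real.log (1 + q * ε₂), Real.exp x / x) /
        (q * (ε₂ - ε₁))) :
    (1 / (N : ℝ)) * ∑ n ∈ Finset.Icc 1 N, (1 / (ε₂ - ε₁)) *
        ∫ g in ε₁..ε₂,
          ((min A n : ℝ) * τb -
            (τs + (min A n : ℝ) * D / (W * Real.logb 2 (1 + q * g))) -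
            ω₁ * (A : ℝ) * P -
            ω₂ * (q * (min A n : ℝ) * D / (W * Real.logb 2 (1 + q * g)) + ℓ)) =
      -C₂ * (A : ℝ) ^ 2 / (2 * (N : ℝ)) + (C₂ + C₂ / (2 * (N : ℝ)) - ω₁ * P) * (A : ℝ)
        - τs - ω₂ * ℓ := by
  have hN : (0 : ℝ) < N := by exact_mod_cast hA.trans hAN
  have hd : 0 < ε₂ - ε₁ := sub_pos.2 hε
  set J : ℝ := ∫ g in ε₁..ε₂, (Real.log (1 + q * g))⁻¹ with hJ
  have hint : IntervalIntegrable (fun g => (Real.log (1 + q * g))⁻¹) MeasureTheory.volume ε₁ ε₂ :=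
    ((continuousOn_log_one_add_mul hq hε₁ hε).inv₀
      fun _ hg => (log_one_add_mul_pos hq hε₁ hε hg).ne').intervalIntegrable
  rw [integral_exp_div_eq hq hε₁ hε, ← hJ] at hC₂
  have key : ∀ m : ℝ, (1 / (ε₂ - ε₁)) * ∫ g in ε₁..ε₂,
      (m * τb - (τs + m * D / (W * Real.logb 2 (1 + q * g))) - ω₁ * (A : ℝ) * P -
        ω₂ * (q * m * D / (W * Real.logb 2 (1 + q * g)) + ℓ)) =
      m * C₂ - (τs + ω₁ * A * P + ω₂ * ℓ) := by
    intro m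
    have hfun : ∀ g : ℝ,
        (m * τb - (τs + m * D / (W * Real.logb 2 (1 + q * g))) - ω₁ * (A : ℝ) * P -
          ω₂ * (q * m * D / (W * Real.logb 2 (1 + q * g)) + ℓ)) =
        (m * τb - τs - ω₁ * A * P - ω₂ * ℓ) -
          (m * (D + ω₂ * q * D) / W * Real.log 2) * (Real.log (1 + q * g))⁻¹ := by
      intro g
      simp only [Real.logb, div_eq_mul_inv, mul_inv, inv_inv]
      ring
    simp only [hfun]
    rw [intervalIntegral.integral_sub (by simp) (hint.const_mul _),
      intervalIntegral.integral_const, intervalIntegral.integral_const_mul, ← hJ, hC₂, smul_eq_mul]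
    field_simp
    ring
  simp only [key]
  rw [Finset.sum_sub_distrib, ← Finset.sum_mul, sum_Icc_one_min A N hAN]
  simp only [Finset.sum_const, Nat.card_Icc, Nat.add_sub_cancel, nsmul_eq_mul]
  field_simp
  ring
end

section
/- Let γ > 0 and ω₂ > 0 be real numbers. Then the function h(β) = β + ω₂·β·(2^{1/β} − 1)/γ is strictly convex on the interval (0, ∞). -/
/-- The perspective `x ↦ x * f (1 / x)` of a strictly convex function on the positive reals
is strictly convex on the positive reals. -/
theorem StrictConvexOn.perspective_Ioi {f : ℝ → ℝ} (hf : StrictConvexOn ℝ (Set.Ioi 0) f) :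
    StrictConvexOn ℝ (Set.Ioi (0 : ℝ)) (fun x : ℝ => x * f (1 / x)) := by
  refine ⟨convex_Ioi 0, fun x hx y hy hxy a b ha hb hab => ?_⟩
  simp only [Set.mem_Ioi] at hx hy
  simp only [smul_eq_mul]
  have hz : 0 < a * x + b * y := by positivity
  have hne : 1 / x ≠ 1 / y := by simpa using hxy
  have key := hf.2 (Set.mem_Ioi.2 (one_div_pos.2 hx)) (Set.mem_Ioi.2 (one_div_pos.2 hy)) hne
    (show 0 < a * x / (a * x + b * y) by positivity)
    (show 0 < b * y / (a * x + b * y) by positivity) (by rw [← add_div, div_self hz.ne'])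
  have hcomb : a * x / (a * x + b * y) * (1 / x) + b * y / (a * x + b * y) * (1 / y)
      = (a + b) / (a * x + b * y) := by
    field_simp
  simp only [smul_eq_mul, hcomb, hab] at key
  calc (a * x + b * y) * f (1 / (a * x + b * y))
      < (a * x + b * y) * (a * x / (a * x + b * y) * f (1 / x)
          + b * y / (a * x + b * y) * f (1 / y)) := mul_lt_mul_of_pos_left key hz
    _ = a * (x * f (1 / x)) + b * (y * f (1 / y)) := by
      field_simp

theorem Real.strictConvexOn_two_rpow : StrictConvexOn ℝ Set.univ (fun t : ℝ => (2 : ℝ) ^ t) := by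
  have hlog : Real.log 2 ≠ 0 := (Real.log_pos one_lt_two).ne'
  refine ⟨convex_univ, fun x _ y _ hxy a b ha hb hab => ?_⟩
  have h := strictConvexOn_exp.2 (Set.mem_univ (Real.log 2 * x)) (Set.mem_univ (Real.log 2 * y))
    (fun h => hxy (mul_left_cancel₀ hlog h)) ha hb hab
  simp only [smul_eq_mul, Real.rpow_def_of_pos two_pos] at h ⊢
  rwa [show Real.log 2 * (a * x + b * y) = a * (Real.log 2 * x) + b * (Real.log 2 * y) by ring]

theorem stmt_17 (γ ω₂ : ℝ) (hγ : 0 < γ) (hω₂ : 0 < ω₂) :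
    StrictConvexOn ℝ (Set.Ioi (0 : ℝ))
      (fun β : ℝ => β + ω₂ * β * ((2 : ℝ) ^ (1 / β) - 1) / γ) := by
  have hp := (Real.strictConvexOn_two_rpow.subset (Set.subset_univ _)
    (convex_Ioi 0)).perspective_Ioi
  refine ⟨convex_Ioi 0, fun x hx y hy hxy a b ha hb hab => ?_⟩
  have h := mul_lt_mul_of_pos_left (hp.2 hx hy hxy ha hb hab) (div_pos hω₂ hγ)
  simp only [smul_eq_mul] at h ⊢
  have split (z r : ℝ) : z + ω₂ * z * (r - 1) / γ = (1 - ω₂ / γ) * z + ω₂ / γ * (z * r) := by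
    ring
  rw [split, split, split]
  linarith
end

section
/- Let γ > 0, ω₂ > 0, and q^max > 0 be real numbers, and define f(q) = (1 + ω₂·q)/log₂(1 + q·γ) for q > 0. Suppose β₀ > 0 satisfies ((ln 2)/β₀ − 1)·e^{((ln 2)/β₀ − 1)} = (γ − ω₂)/(e·ω₂) and β₀ ≥ 1/log₂(1 + γ·q^max). Then q** := (2^{1/β₀} − 1)/γ satisfies 0 < q** ≤ q^max, and f(q**) ≤ f(q) for every q ∈ (0, q^max]. -/
theorem stmt_19 (γ ω₂ qmax : ℝ) (hγ : 0 < γ) (hω₂ : 0 < ω₂) (hqmax : 0 < qmax)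
    (f : ℝ → ℝ) (hf : ∀ q : ℝ, 0 < q → f q = (1 + ω₂ * q) / Real.logb 2 (1 + q * γ))
    (β₀ : ℝ) (hβ₀pos : 0 < β₀)
    (hstat : (Real.log 2 / β₀ - 1) * Real.exp (Real.log 2 / β₀ - 1) =
      (γ - ω₂) / (Real.exp 1 * ω₂))
    (hβ₀ : 1 / Real.logb 2 (1 + γ * qmax) ≤ β₀) :
    0 < ((2 : ℝ) ^ (1 / β₀) - 1) / γ ∧ ((2 : ℝ) ^ (1 / β₀) - 1) / γ ≤ qmax ∧
      ∀ q : ℝ, 0 < q → q ≤ qmax → f (((2 : ℝ) ^ (1 / β₀) - 1) / γ) ≤ f q := by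
  have hlog2 : 0 < Real.log 2 := Real.log_pos one_lt_two
  have hspos : 0 < Real.log 2 / β₀ := div_pos hlog2 hβ₀pos
  have hpow : (2 : ℝ) ^ (1 / β₀) = Real.exp (Real.log 2 / β₀) := by
    rw [Real.rpow_def_of_pos two_pos, mul_one_div]
  have hqpos : 0 < ((2 : ℝ) ^ (1 / β₀) - 1) / γ := by
    rw [hpow]
    exact div_pos (sub_pos.2 (Real.one_lt_exp_iff.2 hspos)) hγ
  have hmax : 1 < 1 + γ * qmax := by linarith [mul_pos hγ hqmax]
  refine ⟨hqpos, ?_, fun q hq _ => ?_⟩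
  · have hle := (one_div_le (Real.logb_pos one_lt_two hmax) hβ₀pos).1 hβ₀
    have := (Real.le_logb_iff_rpow_le one_lt_two (by linarith)).1 hle
    rw [div_le_iff₀ hγ]
    linarith
  · rw [hf _ hqpos, hf q hq, div_mul_cancel₀ _ hγ.ne', hpow]
    generalize Real.log 2 / β₀ = s at *
    have hE : 0 < Real.exp s := Real.exp_pos s
    have hcrit : ω₂ * (s - 1) * Real.exp s = γ - ω₂ := by
      rw [Real.exp_sub] at hstat
      have he := Real.exp_pos 1
      field_simp at hstat
      linarith
    have hx : 1 < 1 + q * γ := by linarith [mul_pos hq hγ]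
    have hlogx : 0 < Real.log (1 + q * γ) := Real.log_pos hx
    have htangent : Real.log (1 + q * γ) - s ≤ (1 + q * γ) / Real.exp s - 1 := by
      have h := Real.log_le_sub_one_of_pos (div_pos (by linarith : 0 < 1 + q * γ) hE)
      rwa [Real.log_div (by linarith) hE.ne', Real.log_exp] at h
    have hscaled := mul_le_mul_of_nonneg_left htangent (mul_pos hω₂ hE).le
    have hcancel : ω₂ * Real.exp s * ((1 + q * γ) / Real.exp s - 1) =
        ω₂ * (1 + q * γ) - ω₂ * Real.exp s := by
      field_simp
    have hvalue : 1 + ω₂ * ((Real.exp s - 1) / γ) = ω₂ * s * Real.exp s / γ := by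
      field_simp
      linarith
    have hlogb : Real.logb 2 (1 + (Real.exp s - 1)) = s / Real.log 2 := by
      rw [add_sub_cancel, Real.logb, Real.log_exp]
    rw [hvalue, hlogb, Real.logb, div_div_eq_mul_div, div_div_eq_mul_div,
      div_le_div_iff₀ hspos hlogx]
    have hkey : ω₂ * Real.exp s * Real.log (1 + q * γ) ≤ γ * (1 + ω₂ * q) := by
      linarith
    calc ω₂ * s * Real.exp s / γ * Real.log 2 * Real.log (1 + q * γ)
        = s * Real.log 2 / γ * (ω₂ * Real.exp s * Real.log (1 + q * γ)) := by ring
      _ ≤ s * Real.log 2 / γ * (γ * (1 + ω₂ * q)) := by gcongr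
      _ = (1 + ω₂ * q) * Real.log 2 * s := by field_simp
end
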